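/- arXiv:1910.02479 — 5 statements merged into one kernel-verified Lean document; each statement's English description precedes it below -/
import Mathlib

section
/- Let (S, Σ) be a measurable space and P a Markov kernel on S. Suppose there exist an integer n₀ ≥ 1, a constant η ∈ (0, 1], and a probability measure λ on S such that the n₀-step iterate satisfies P^{n₀}(x, A) ≥ η λ(A) for every x ∈ S and every measurable set A ⊆ S. Then there exists exactly one probability measure μ on S that is invariant for P, i.e., satisfying μ(A) = ∫_S P(x, A) μ(dx) for all measurable A. -/
open MeasureTheory ProbabilityTheory

/-- The `m`-step iterate of a Markov kernel: `P^0 = id`, `P^(m+1) x A = ∫ P^m(y, A) P(x, dy)`. -/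
noncomputable def kernelIter {S : Type*} [MeasurableSpace S] (P : Kernel S S) : ℕ → Kernel S S
  | 0 => Kernel.id
  | n + 1 => (kernelIter P n) ∘ₖ P

open scoped ENNReal

section

variable {S : Type*} [MeasurableSpace S]

theorem kernelIter_eq_pow (P : Kernel S S) (n : ℕ) : kernelIter P n = P ^ n := by
  induction n with
  | zero => rfl
  | succ n ih => rw [kernelIter, ih, pow_succ]; rfl

theorem isMarkovKernel_pow (P : Kernel S S) [IsMarkovKernel P] (n : ℕ) :
    IsMarkovKernel (P ^ n) := by
  induction n with
  | zero => exact inferInstanceAs (IsMarkovKernel Kernel.id)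
  | succ n ih => rw [pow_succ]; exact inferInstanceAs (IsMarkovKernel ((P ^ n : Kernel S S) ∘ₖ P))

theorem invariant_pow {P : Kernel S S} {μ : Measure S} (h : P.Invariant μ) (n : ℕ) :
    (P ^ n).Invariant μ := by
  induction n with
  | zero => exact Measure.id_comp
  | succ n ih => rw [pow_succ]; exact ih.comp h

theorem invariant_iff_forall_apply {P : Kernel S S} {μ : Measure S} :
    P.Invariant μ ↔ ∀ A : Set S, MeasurableSet A → μ A = ∫⁻ x, P x A ∂μ := by
  constructor
  · intro h A hA
    rw [← Measure.bind_apply hA P.aemeasurable, h.def]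
  · intro h
    ext A hA
    rw [Measure.bind_apply hA P.aemeasurable, h A hA]

/-- A kernel dominating a finite measure `ν` uniformly splits as `ν` plus a residual kernel. -/
theorem exists_eq_add_const (Q : Kernel S S) (ν : Measure S) [IsFiniteMeasure ν]
    (h : ∀ x, ν ≤ Q x) : ∃ R : Kernel S S, Q = R + Kernel.const S ν := by
  refine ⟨⟨fun x => Q x - ν, Measure.measurable_of_measurable_coe _ fun s hs => ?_⟩, ?_⟩
  · simp_rw [Measure.sub_apply hs (h _)]
    exact (Q.measurable_coe hs).sub measurable_const
  · ext1 x
    exact (Measure.sub_add_cancel_of_le (h x)).symm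

/-- The measure `∑ₖ Rᵏ ∘ₘ ν`, the minimal solution of `μ = ν + R ∘ₘ μ`. -/
noncomputable def neumannSeries (R : Kernel S S) (ν : Measure S) : Measure S :=
  Measure.sum fun k : ℕ => (R ^ k : Kernel S S) ∘ₘ ν

theorem pow_zero_comp (R : Kernel S S) (ν : Measure S) : (R ^ 0 : Kernel S S) ∘ₘ ν = ν :=
  Measure.id_comp

theorem pow_succ_comp (R : Kernel S S) (ν : Measure S) (k : ℕ) :
    (R ^ (k + 1) : Kernel S S) ∘ₘ ν = R ∘ₘ ((R ^ k : Kernel S S) ∘ₘ ν) := by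
  rw [pow_succ', Measure.comp_assoc]; rfl

theorem add_comp_neumannSeries (R : Kernel S S) (ν : Measure S) :
    ν + R ∘ₘ neumannSeries R ν = neumannSeries R ν := by
  rw [neumannSeries, Measure.bind_sum _ _ R.aemeasurable]
  simp_rw [← pow_succ_comp]
  ext s hs
  rw [Measure.add_apply, Measure.sum_apply _ hs, Measure.sum_apply _ hs,
    tsum_eq_zero_add' (f := fun k => ((R ^ k : Kernel S S) ∘ₘ ν) s) ENNReal.summable,
    pow_zero_comp]

theorem neumannSeries_le {R : Kernel S S} {ν μ : Measure S} (h : μ = ν + R ∘ₘ μ) :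
    neumannSeries R ν ≤ μ := by
  have key (n : ℕ) : μ = ∑ k ∈ Finset.range n, (R ^ k : Kernel S S) ∘ₘ ν
      + (R ^ n : Kernel S S) ∘ₘ μ := by
    induction n with
    | zero => rw [Finset.sum_range_zero, zero_add, pow_zero_comp]
    | succ n ih =>
      have hn : (R ^ n : Kernel S S) ∘ₘ μ
          = (R ^ n : Kernel S S) ∘ₘ ν + (R ^ (n + 1) : Kernel S S) ∘ₘ μ := by
        conv_lhs => rw [h, Measure.comp_add, Measure.comp_assoc]
        rw [pow_succ]; rfl
      rw [Finset.sum_range_succ, add_assoc, ← hn]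
      exact ih
  refine Measure.le_iff.2 fun s hs => ?_
  rw [neumannSeries, Measure.sum_apply _ hs]
  refine ENNReal.tsum_le_of_sum_range_le fun n => ?_
  conv_rhs => rw [key n]
  rw [Measure.add_apply, Measure.finsetSum_apply]
  exact le_self_add

theorem neumannSeries_apply_univ {R : Kernel S S} {r : ℝ≥0∞} (hR : ∀ x, R x Set.univ = r)
    (ν : Measure S) : neumannSeries R ν Set.univ = (1 - r)⁻¹ * ν Set.univ := by
  have hpow (k : ℕ) : ((R ^ k : Kernel S S) ∘ₘ ν) Set.univ = r ^ k * ν Set.univ := by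
    induction k with
    | zero => rw [pow_zero_comp, pow_zero, one_mul]
    | succ k ih =>
      rw [pow_succ_comp, Measure.bind_apply .univ R.aemeasurable]
      simp_rw [hR]
      rw [lintegral_const, ih, pow_succ', mul_assoc]
  rw [neumannSeries, Measure.sum_apply _ .univ]
  simp_rw [hpow]
  rw [ENNReal.tsum_mul_right, ENNReal.tsum_geometric]

/-- A Markov kernel uniformly dominating a nonzero finite measure has exactly one invariant
probability measure. -/
theorem existsUnique_invariant_of_forall_le (Q : Kernel S S) [IsMarkovKernel Q] (ν : Measure S)
    [IsFiniteMeasure ν] (hν : ν ≠ 0) (h : ∀ x, ν ≤ Q x) :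
    ∃! μ : Measure S, IsProbabilityMeasure μ ∧ Q.Invariant μ := by
  obtain ⟨R, hQ⟩ := exists_eq_add_const Q ν h
  have hν0 : ν Set.univ ≠ 0 := by rwa [Ne, Measure.measure_univ_eq_zero]
  have hadd (x : S) : R x Set.univ + ν Set.univ = 1 := by
    have : Q x Set.univ = 1 := measure_univ
    rwa [hQ] at this
  have hR (x : S) : R x Set.univ = 1 - ν Set.univ :=
    ENNReal.eq_sub_of_add_eq (measure_ne_top ν _) (hadd x)
  have hν1 : ν Set.univ ≤ 1 := by
    obtain ⟨x⟩ : Nonempty S := by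
      by_contra hS
      rw [not_nonempty_iff] at hS
      exact hν (Subsingleton.elim _ _)
    exact hadd x ▸ le_add_self
  have hiff (μ : Measure S) [IsProbabilityMeasure μ] : Q.Invariant μ ↔ ν + R ∘ₘ μ = μ := by
    rw [Kernel.Invariant, hQ, Measure.add_comp, Measure.const_comp, measure_univ, one_smul,
      add_comm]
  have hprob : IsProbabilityMeasure (neumannSeries R ν) := by
    refine ⟨?_⟩
    rw [neumannSeries_apply_univ hR, ENNReal.sub_sub_cancel ENNReal.one_ne_top hν1,
      ENNReal.inv_mul_cancel hν0 (measure_ne_top ν _)]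
  refine ⟨neumannSeries R ν, ⟨hprob, (hiff _).2 (add_comp_neumannSeries R ν)⟩, ?_⟩
  rintro μ ⟨hμ, hinv⟩
  exact (Measure.eq_of_le_of_isProbabilityMeasure
    (neumannSeries_le ((hiff μ).1 hinv).symm)).symm

/-- If some power of a Markov kernel has exactly one invariant probability measure, then so does
the kernel itself. -/
theorem existsUnique_invariant_of_pow (P : Kernel S S) [IsMarkovKernel P] (n : ℕ)
    (h : ∃! μ : Measure S, IsProbabilityMeasure μ ∧ (P ^ n).Invariant μ) :
    ∃! μ : Measure S, IsProbabilityMeasure μ ∧ P.Invariant μ := by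
  obtain ⟨μ, ⟨hμ, hinv⟩, huniq⟩ := h
  refine ⟨μ, ⟨hμ, huniq _ ⟨inferInstance, ?_⟩⟩, fun ν hν => huniq ν ⟨hν.1, invariant_pow hν.2 n⟩⟩
  have hcomm : (P ^ n : Kernel S S) ∘ₖ P = P ∘ₖ (P ^ n : Kernel S S) :=
    (pow_succ P n).symm.trans (pow_succ' P n)
  rw [Kernel.Invariant, Measure.comp_assoc, hcomm, ← Measure.comp_assoc, hinv.def]

end

/-- **Doeblin's theorem.** If a Markov kernel `P` on a measurable space `S` satisfies the uniform
minorization condition `P^{n₀}(x, A) ≥ η λ(A)` for some `n₀ ≥ 1`, `η ∈ (0, 1]` and a probability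
measure `λ`, then `P` has exactly one invariant probability measure. -/
theorem exists_unique_invariant_of_minorization
    {S : Type*} [MeasurableSpace S] (P : Kernel S S) [IsMarkovKernel P]
    (n₀ : ℕ) (hn₀ : 1 ≤ n₀) (η : ℝ) (hη0 : 0 < η) (hη1 : η ≤ 1)
    (lam : Measure S) [IsProbabilityMeasure lam]
    (hminor : ∀ x : S, ∀ A : Set S, MeasurableSet A →
      ENNReal.ofReal η * lam A ≤ kernelIter P n₀ x A) :
    ∃! μ : Measure S, IsProbabilityMeasure μ ∧
      (∀ A : Set S, MeasurableSet A → μ A = ∫⁻ x, P x A ∂μ) := by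
  have := isMarkovKernel_pow P n₀
  have : IsFiniteMeasure (ENNReal.ofReal η • lam) :=
    Measure.smul_finite lam ENNReal.ofReal_ne_top
  have hne : ENNReal.ofReal η • lam ≠ 0 := by
    rw [Ne, ← Measure.measure_univ_eq_zero]
    simpa using hη0
  simp_rw [← invariant_iff_forall_apply]
  refine existsUnique_invariant_of_pow P n₀
    (existsUnique_invariant_of_forall_le _ (ENNReal.ofReal η • lam) hne fun x =>
      Measure.le_iff.2 fun A hA => ?_)
  rw [← kernelIter_eq_pow]
  exact hminor x A hA
end

section
/- Let (S, Σ) be a measurable space and P a Markov kernel on S satisfying the uniform minorization condition: there exist an integer n₀ ≥ 1, η ∈ (0, 1], and a probability measure λ on S with P^{n₀}(x, A) ≥ η λ(A) for every x ∈ S and measurable A ⊆ S. Let μ be the (unique) invariant probability measure of P. Then for every bounded measurable function θ : S → ℝ and every integer m ≥ 0, sup_{x ∈ S} | (P^m θ)(x) − ∫_S θ dμ | ≤ 2 (1 − η)^{⌊m / n₀⌋} ‖θ‖_∞. -/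
open MeasureTheory ProbabilityTheory

lemma kernelIter_add {S : Type*} [MeasurableSpace S] (P : Kernel S S) (m n : ℕ) :
    kernelIter P (m + n) = kernelIter P m ∘ₖ kernelIter P n := by
  induction n with
  | zero => simp [kernelIter]
  | succ n ih => rw [← add_assoc, kernelIter, ih, kernelIter, Kernel.comp_assoc]

instance isMarkovKernel_kernelIter {S : Type*} [MeasurableSpace S] (P : Kernel S S)
    [IsMarkovKernel P] (n : ℕ) : IsMarkovKernel (kernelIter P n) := by
  induction n with
  | zero => exact inferInstanceAs (IsMarkovKernel Kernel.id)
  | succ n ih => exact inferInstanceAs (IsMarkovKernel (kernelIter P n ∘ₖ P))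

lemma invariant_kernelIter {S : Type*} [MeasurableSpace S] {P : Kernel S S} {μ : Measure S}
    (h : P.Invariant μ) (n : ℕ) : (kernelIter P n).Invariant μ := by
  induction n with
  | zero => exact Measure.id_comp
  | succ n ih => exact ih.comp h

lemma integrable_of_abs_le {S : Type*} [MeasurableSpace S] {ν : Measure S} [IsFiniteMeasure ν]
    {f : S → ℝ} (hf : Measurable f) {C : ℝ} (hC : ∀ x, |f x| ≤ C) : Integrable f ν :=
  .of_bound hf.aestronglyMeasurable C (.of_forall hC)

lemma integral_mem_Icc {S : Type*} [MeasurableSpace S] {ν : Measure S} [IsProbabilityMeasure ν]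
    {f : S → ℝ} (hf : Integrable f ν) {a b : ℝ} (hab : ∀ x, f x ∈ Set.Icc a b) :
    ∫ x, f x ∂ν ∈ Set.Icc a b := by
  constructor
  · simpa using integral_mono (integrable_const a) hf fun x => (hab x).1
  · simpa using integral_mono hf (integrable_const b) fun x => (hab x).2

lemma mul_integral_le_of_smul_le {S : Type*} [MeasurableSpace S] {lam ν : Measure S}
    {η : ℝ} (hη : 0 ≤ η) (h : ENNReal.ofReal η • lam ≤ ν) {f : S → ℝ} (hf : Integrable f ν)
    (hf0 : ∀ x, 0 ≤ f x) : η * ∫ x, f x ∂lam ≤ ∫ x, f x ∂ν := by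
  have := integral_mono_measure h (.of_forall hf0) hf
  rwa [integral_smul_measure, ENNReal.toReal_ofReal hη, smul_eq_mul] at this

/-- Averaging against a probability measure minorized by `η • lam` shrinks the range of `f`
by the factor `1 - η`, to an interval that depends only on `lam`. -/
lemma integral_mem_Icc_of_smul_le {S : Type*} [MeasurableSpace S] {lam ν : Measure S}
    [IsProbabilityMeasure lam] [IsProbabilityMeasure ν] {η : ℝ} (hη : 0 ≤ η)
    (h : ENNReal.ofReal η • lam ≤ ν) {f : S → ℝ} (hlam : Integrable f lam) (hν : Integrable f ν)
    {a b : ℝ} (hab : ∀ x, f x ∈ Set.Icc a b) :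
    ∫ x, f x ∂ν ∈ Set.Icc (η * ∫ x, f x ∂lam + (1 - η) * a)
      (η * ∫ x, f x ∂lam + (1 - η) * b) := by
  have ha := mul_integral_le_of_smul_le hη h (hν.sub (integrable_const a))
    fun x => sub_nonneg.2 (hab x).1
  have hb := mul_integral_le_of_smul_le hη h ((integrable_const b).sub hν)
    fun x => sub_nonneg.2 (hab x).2
  simp only [Pi.sub_apply] at ha hb
  rw [integral_sub hlam (integrable_const a), integral_sub hν (integrable_const a)] at ha
  rw [integral_sub (integrable_const b) hlam, integral_sub (integrable_const b) hν] at hb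
  simp only [integral_const, probReal_univ, one_smul] at ha hb
  constructor <;> linarith

lemma abs_integral_le_of_abs_le {S : Type*} [MeasurableSpace S] {ν : Measure S}
    [IsProbabilityMeasure ν] {f : S → ℝ} {C : ℝ} (hC : ∀ x, |f x| ≤ C) : |∫ x, f x ∂ν| ≤ C := by
  simpa using norm_integral_le_of_norm_le_const (μ := ν) (f := f) (.of_forall hC)

lemma measurable_integral_kernel {S : Type*} [MeasurableSpace S] (K : Kernel S S)
    [IsMarkovKernel K] {f : S → ℝ} (hf : Measurable f) : Measurable fun x => ∫ y, f y ∂(K x) :=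
  hf.stronglyMeasurable.integral_kernel.measurable

lemma exists_Icc_integral_kernelIter {S : Type*} [MeasurableSpace S] (P : Kernel S S)
    [IsMarkovKernel P] {n₀ : ℕ} {η : ℝ} (hη : 0 ≤ η) {lam : Measure S} [IsProbabilityMeasure lam]
    (hminor : ∀ x, ENNReal.ofReal η • lam ≤ kernelIter P n₀ x)
    {θ : S → ℝ} (hθ : Measurable θ) {C : ℝ} (hC : ∀ x, |θ x| ≤ C) (r k : ℕ) :
    ∃ a b : ℝ, b - a = 2 * (1 - η) ^ k * C ∧
      ∀ x, ∫ y, θ y ∂(kernelIter P (r + n₀ * k) x) ∈ Set.Icc a b := by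
  induction k with
  | zero => exact ⟨-C, C, by ring, fun x => abs_le.1 (abs_integral_le_of_abs_le hC)⟩
  | succ k ih =>
    obtain ⟨a, b, hab, hmem⟩ := ih
    let f : S → ℝ := fun x => ∫ y, θ y ∂(kernelIter P (r + n₀ * k) x)
    have hfint (ν : Measure S) [IsProbabilityMeasure ν] : Integrable f ν :=
      integrable_of_abs_le (measurable_integral_kernel _ hθ) fun _ => abs_integral_le_of_abs_le hC
    refine ⟨η * ∫ x, f x ∂lam + (1 - η) * a, η * ∫ x, f x ∂lam + (1 - η) * b, ?_, fun x => ?_⟩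
    · linear_combination (1 - η) * hab
    · rw [Nat.mul_succ, ← add_assoc, kernelIter_add,
        Kernel.integral_comp (integrable_of_abs_le hθ hC)]
      exact integral_mem_Icc_of_smul_le hη (hminor x) (hfint _) (hfint _) hmem

/-- Geometric ergodicity under the uniform (Doeblin) minorization condition: if
`P^{n₀}(x, A) ≥ η λ(A)` for all `x, A` and `μ` is the invariant probability measure of `P`,
then `sup_x |(P^m θ)(x) − μ(θ)| ≤ 2 (1 − η)^⌊m/n₀⌋ ‖θ‖_∞` for every bounded measurable `θ`. -/
theorem geometric_ergodicity_of_minorization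
    {S : Type*} [MeasurableSpace S] (P : Kernel S S) [IsMarkovKernel P]
    (n₀ : ℕ) (hn₀ : 1 ≤ n₀) (η : ℝ) (hη0 : 0 < η) (hη1 : η ≤ 1)
    (lam : Measure S) [IsProbabilityMeasure lam]
    (hminor : ∀ x : S, ∀ A : Set S, MeasurableSet A →
      ENNReal.ofReal η * lam A ≤ kernelIter P n₀ x A)
    (μ : Measure S) [IsProbabilityMeasure μ]
    (hinv : ∀ A : Set S, MeasurableSet A → μ A = ∫⁻ x, P x A ∂μ)
    (θ : S → ℝ) (hθmeas : Measurable θ) (Cθ : ℝ) (hθbd : ∀ x, |θ x| ≤ Cθ)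
    (m : ℕ) :
    ∀ x : S, |(∫ y, θ y ∂(kernelIter P m x)) - ∫ y, θ y ∂μ| ≤
      2 * (1 - η) ^ (m / n₀) * Cθ := by
  intro x
  have hPμ : P.Invariant μ :=
    Measure.ext fun A hA => by rw [Measure.bind_apply hA P.aemeasurable, hinv A hA]
  obtain ⟨a, b, hab, hmem⟩ := exists_Icc_integral_kernelIter P hη0.le
    (fun x => Measure.le_iff.2 (hminor x)) hθmeas hθbd (m % n₀) (m / n₀)
  rw [Nat.mod_add_div] at hmem
  have hμ : ∫ y, θ y ∂μ ∈ Set.Icc a b := by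
    rw [← (invariant_kernelIter hPμ m).def,
      Measure.comp_eq_comp_const_apply, Kernel.integral_comp (integrable_of_abs_le hθmeas hθbd),
      Kernel.const_apply]
    exact integral_mem_Icc (integrable_of_abs_le (measurable_integral_kernel _ hθmeas)
      fun _ => abs_integral_le_of_abs_le hθbd) hmem
  rw [← hab]
  exact abs_sub_le_of_le_of_le (hmem x).1 (hmem x).2 hμ.1 hμ.2
end

section
/- Fix T > 0, a maximal time step h* > 0, η ∈ (0, 1], and a probability measure λ on a measurable space (S, Σ). Let (P_h)_{0 < h ≤ h*} be a family of Markov kernels on S such that for every h ∈ (0, h*], every x ∈ S and every measurable A ⊆ S, P_h^{⌈T/h⌉}(x, A) ≥ η λ(A). Then for each h ∈ (0, h*] the kernel P_h has a unique invariant probability measure μ_h, and there exist constants C > 0 and κ > 0 depending only on T, η and h* (in particular independent of h) such that for every h ∈ (0, h*], every bounded measurable θ : S → ℝ, and every integer m ≥ 1, sup_{x ∈ S} | (P_h^m θ)(x) − ∫_S θ dμ_h | ≤ C e^{−κ m h} ‖θ‖_∞. -/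
open MeasureTheory ProbabilityTheory

namespace ProbabilityTheory.Kernel

variable {S : Type*} [MeasurableSpace S]

instance isMarkovKernel_kernelIter (P : Kernel S S) [IsMarkovKernel P] (n : ℕ) :
    IsMarkovKernel (kernelIter P n) := by
  induction n with
  | zero => exact inferInstanceAs (IsMarkovKernel Kernel.id)
  | succ n ih => exact inferInstanceAs (IsMarkovKernel (kernelIter P n ∘ₖ P))

lemma kernelIter_add (P : Kernel S S) (m n : ℕ) :
    kernelIter P (m + n) = kernelIter P m ∘ₖ kernelIter P n := by
  induction n with
  | zero => exact (Kernel.comp_id _).symm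
  | succ n ih =>
    change kernelIter P (m + n) ∘ₖ P = kernelIter P m ∘ₖ (kernelIter P n ∘ₖ P)
    rw [ih, Kernel.comp_assoc]

lemma kernelIter_one (P : Kernel S S) : kernelIter P 1 = P := Kernel.id_comp P

lemma Invariant.iterate {P : Kernel S S} {μ : Measure S} (hμ : Invariant P μ) (n : ℕ) :
    Invariant (kernelIter P n) μ := by
  induction n with
  | zero => exact Measure.id_comp
  | succ n ih => exact ih.comp hμ

lemma invariant_iff {P : Kernel S S} {μ : Measure S} :
    Invariant P μ ↔ ∀ A, MeasurableSet A → μ A = ∫⁻ x, P x A ∂μ := by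
  refine ⟨fun h A hA ↦ ?_, fun h ↦ Measure.ext fun A hA ↦ ?_⟩
  · rw [← Measure.bind_apply hA P.aemeasurable, h.def]
  · rw [Measure.bind_apply hA P.aemeasurable, h A hA]

section Minorization

variable {Q : Kernel S S} [IsMarkovKernel Q] {lam : Measure S} [IsProbabilityMeasure lam]

/-- A kernel satisfying a one-step minorization condition on the whole space has an invariant
probability measure `e ∑ₖ λ Rᵏ`, where `R = Q - e λ` is the residual kernel. -/
lemma exists_invariant_of_minorization {e : ENNReal} (he0 : e ≠ 0) (he1 : e ≤ 1)
    (hQ : ∀ x, e • lam ≤ Q x) :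
    ∃ μ : Measure S, IsProbabilityMeasure μ ∧ Invariant Q μ := by
  have he_top : e ≠ ⊤ := ne_top_of_le_ne_top ENNReal.one_ne_top he1
  have : IsFiniteMeasure (e • lam) := ⟨by simpa using he_top.lt_top⟩
  let R : Kernel S S :=
    { toFun := fun x ↦ Q x - e • lam
      measurable' := Measure.measurable_of_measurable_coe _ fun A hA ↦ by
        simp_rw [fun x ↦ Measure.sub_apply hA (hQ x)]
        exact (Q.measurable_coe hA).sub measurable_const }
  have hR : ∀ x, R x + e • lam = Q x := fun x ↦ Measure.sub_add_cancel_of_le (hQ x)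
  have hR_univ : ∀ x, R x Set.univ = 1 - e := fun x ↦ by
    change (Q x - e • lam) Set.univ = _
    simp [Measure.sub_apply MeasurableSet.univ (hQ x)]
  let ν : ℕ → Measure S := fun k ↦ (fun ρ : Measure S ↦ ρ.bind R)^[k] lam
  have hν_succ : ∀ k, ν (k + 1) = (ν k).bind R := fun k ↦ Function.iterate_succ_apply' _ _ _
  have hν_univ : ∀ k, ν k Set.univ = (1 - e) ^ k := by
    intro k
    induction k with
    | zero => simp [ν]
    | succ k ih =>
      rw [hν_succ, Measure.bind_apply .univ R.aemeasurable]
      simp [hR_univ, ih, pow_succ']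
  have hmass : e * (Measure.sum ν) Set.univ = 1 := by
    rw [Measure.sum_apply _ .univ]
    simp_rw [hν_univ]
    rw [ENNReal.tsum_geometric, ENNReal.sub_sub_cancel ENNReal.one_ne_top he1,
      ENNReal.mul_inv_cancel he0 he_top]
  refine ⟨e • Measure.sum ν, ⟨by simpa using hmass⟩, invariant_iff.2 fun A hA ↦ ?_⟩
  have hsplit : ∀ x, Q x A = R x A + e * lam A := fun x ↦ by
    rw [← hR x]; simp
  simp_rw [hsplit]
  rw [lintegral_add_right _ measurable_const, MeasureTheory.lintegral_const, lintegral_smul_measure,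
    lintegral_sum_measure]
  simp only [Measure.smul_apply, smul_eq_mul]
  rw [hmass, mul_one, Measure.sum_apply _ hA, tsum_eq_zero_add' ENNReal.summable, mul_add,
    add_comm]
  simp_rw [hν_succ, Measure.bind_apply hA R.aemeasurable]
  rfl

/-- One application of a minorized kernel shrinks the range of a bounded function by `1 - η`. -/
lemma exists_integral_mem_Icc_of_minorization {η : ℝ} (hη : 0 ≤ η)
    (hQ : ∀ x, ENNReal.ofReal η • lam ≤ Q x) {f : S → ℝ} (hf : Measurable f) {a D : ℝ}
    (hfa : ∀ x, f x ∈ Set.Icc a (a + D)) :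
    ∃ a', ∀ x, ∫ y, f y ∂(Q x) ∈ Set.Icc a' (a' + (1 - η) * D) := by
  have hint (ρ : Measure S) [IsProbabilityMeasure ρ] : Integrable f ρ :=
    .of_mem_Icc a (a + D) hf.aemeasurable (ae_of_all _ hfa)
  have key (x : S) {g : S → ℝ} (hg : ∀ y, 0 ≤ g y) (hgi : Integrable g (Q x)) :
      η * ∫ y, g y ∂lam ≤ ∫ y, g y ∂(Q x) := by
    have := integral_mono_measure (hQ x) (ae_of_all _ hg) hgi
    rwa [integral_smul_measure, ENNReal.toReal_ofReal hη, smul_eq_mul] at this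
  refine ⟨a + η * (∫ y, f y ∂lam - a), fun x ↦ ⟨?_, ?_⟩⟩
  · have := key x (g := fun y ↦ f y - a) (fun y ↦ sub_nonneg.2 (hfa y).1)
      ((hint _).sub (integrable_const _))
    rw [integral_sub (hint _) (integrable_const _), integral_sub (hint _) (integrable_const _)]
      at this
    simp only [MeasureTheory.integral_const, probReal_univ, one_smul] at this
    linarith
  · have := key x (g := fun y ↦ a + D - f y) (fun y ↦ sub_nonneg.2 (hfa y).2)
      ((integrable_const _).sub (hint _))
    rw [integral_sub (integrable_const _) (hint _), integral_sub (integrable_const _) (hint _)]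
      at this
    simp only [MeasureTheory.integral_const, probReal_univ, one_smul] at this
    linarith

end Minorization

lemma integral_mem_Icc {μ : Measure S} [IsProbabilityMeasure μ] {f : S → ℝ} (hf : Measurable f)
    {a b : ℝ} (hfa : ∀ x, f x ∈ Set.Icc a b) : ∫ x, f x ∂μ ∈ Set.Icc a b := by
  have hint : Integrable f μ := .of_mem_Icc a b hf.aemeasurable (ae_of_all _ hfa)
  constructor
  · simpa using integral_mono (integrable_const a) hint fun x ↦ (hfa x).1
  · simpa using integral_mono hint (integrable_const b) fun x ↦ (hfa x).2

lemma Invariant.integral_integral {P : Kernel S S} [IsMarkovKernel P] {μ : Measure S}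
    [IsProbabilityMeasure μ] (hμ : Invariant P μ) {f : S → ℝ} (hf : Integrable f μ) :
    ∫ x, ∫ y, f y ∂(P x) ∂μ = ∫ x, f x ∂μ := by
  have h := Kernel.integral_comp (η := P) (κ := Kernel.const Unit μ) (a := ()) (f := f)
    (by rwa [Kernel.comp_const, hμ.def])
  rw [Kernel.comp_const, hμ.def] at h
  exact h.symm

variable {P : Kernel S S} [IsMarkovKernel P] {lam : Measure S} [IsProbabilityMeasure lam]
  {η : ℝ} {N : ℕ}

lemma exists_integral_kernelIter_mem_Icc (hη : 0 ≤ η)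
    (hP : ∀ x, ENNReal.ofReal η • lam ≤ kernelIter P N x) {f : S → ℝ} (hf : Measurable f)
    {a b : ℝ} (hfa : ∀ x, f x ∈ Set.Icc a b) (r q : ℕ) :
    ∃ a', ∀ x, ∫ y, f y ∂(kernelIter P (r + N * q) x) ∈
      Set.Icc a' (a' + (1 - η) ^ q * (b - a)) := by
  induction q with
  | zero => exact ⟨a, fun x ↦ by simpa using integral_mem_Icc hf hfa⟩
  | succ q ih =>
    obtain ⟨a', ha'⟩ := ih
    obtain ⟨a'', ha''⟩ := exists_integral_mem_Icc_of_minorization hη hP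
      hf.stronglyMeasurable.integral_kernel.measurable ha'
    refine ⟨a'', fun x ↦ ?_⟩
    rw [Nat.mul_succ, ← add_assoc, kernelIter_add, Kernel.integral_comp
      (.of_mem_Icc a b hf.aemeasurable (ae_of_all _ hfa)), pow_succ', mul_assoc]
    exact ha'' x

/-- Geometric convergence to an invariant measure under a minorization condition. -/
lemma Invariant.abs_integral_kernelIter_sub_le (hη : 0 ≤ η)
    (hP : ∀ x, ENNReal.ofReal η • lam ≤ kernelIter P N x) {μ : Measure S}
    [IsProbabilityMeasure μ] (hμ : Invariant P μ) {f : S → ℝ} (hf : Measurable f)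
    {a b : ℝ} (hfa : ∀ x, f x ∈ Set.Icc a b) (r q : ℕ) (x : S) :
    |∫ y, f y ∂(kernelIter P (r + N * q) x) - ∫ y, f y ∂μ| ≤ (1 - η) ^ q * (b - a) := by
  obtain ⟨a', ha'⟩ := exists_integral_kernelIter_mem_Icc hη hP hf hfa r q
  have hmean := integral_mem_Icc (μ := μ) hf.stronglyMeasurable.integral_kernel.measurable ha'
  rw [(hμ.iterate _).integral_integral
    (.of_mem_Icc a b hf.aemeasurable (ae_of_all _ hfa))] at hmean
  rw [abs_le]
  constructor <;> linarith [(ha' x).1, (ha' x).2, hmean.1, hmean.2]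

lemma Invariant.eq_of_minorization (hη0 : 0 < η) (hη1 : η ≤ 1)
    (hP : ∀ x, ENNReal.ofReal η • lam ≤ kernelIter P N x) {μ ν : Measure S}
    [IsProbabilityMeasure μ] [IsProbabilityMeasure ν] (hμ : Invariant P μ) (hν : Invariant P ν) :
    ν = μ := by
  obtain ⟨x⟩ := nonempty_of_isProbabilityMeasure lam
  ext A hA
  have hmem : ∀ y, A.indicator (1 : S → ℝ) y ∈ Set.Icc (0 : ℝ) 1 := fun y ↦
    ⟨Set.indicator_nonneg (fun _ _ ↦ zero_le_one) y,
      Set.indicator_le' (fun _ _ ↦ le_rfl) (fun _ _ ↦ zero_le_one) y⟩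
  have hmeas : Measurable (A.indicator (1 : S → ℝ)) := measurable_one.indicator hA
  have hlim (ρ : Measure S) [IsProbabilityMeasure ρ] (hρ : Invariant P ρ) :
      Filter.Tendsto (fun q ↦ ∫ y, A.indicator (1 : S → ℝ) y ∂(kernelIter P (0 + N * q) x))
        Filter.atTop (nhds (ρ.real A)) := by
    rw [tendsto_iff_norm_sub_tendsto_zero, ← integral_indicator_one hA]
    refine squeeze_zero (fun _ ↦ norm_nonneg _)
      (fun q ↦ hρ.abs_integral_kernelIter_sub_le hη0.le hP hmeas hmem 0 q x) ?_
    simpa using tendsto_pow_atTop_nhds_zero_of_lt_one (sub_nonneg.2 hη1) (sub_lt_self 1 hη0)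
  exact (measureReal_eq_measureReal_iff).1 (tendsto_nhds_unique (hlim ν hν) (hlim μ hμ))

lemma exists_invariant_of_minorization_kernelIter (hη0 : 0 < η) (hη1 : η ≤ 1)
    (hP : ∀ x, ENNReal.ofReal η • lam ≤ kernelIter P N x) :
    ∃ μ : Measure S, IsProbabilityMeasure μ ∧ Invariant P μ := by
  obtain ⟨μ, hμ, hinv⟩ := exists_invariant_of_minorization (by simpa using hη0)
    (by simpa using hη1) hP
  refine ⟨μ, hμ, ?_⟩
  have hcomm : kernelIter P N ∘ₖ P = P ∘ₖ kernelIter P N := by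
    rw [← congrArg (· ∘ₖ kernelIter P N) (kernelIter_one P), ← kernelIter_add, add_comm]
    rfl
  have hPμ : Invariant (kernelIter P N) (μ.bind P) := by
    rw [Invariant, Measure.comp_assoc, hcomm, ← Measure.comp_assoc, hinv.def]
  refine Invariant.eq_of_minorization (N := 1) (lam := lam) hη0 hη1 (fun x ↦ ?_) hinv hPμ
  rw [kernelIter_one]
  exact hP x

end ProbabilityTheory.Kernel

/-- Decay over whole blocks of `⌈T / h⌉` steps, expressed as exponential decay in `m * h`. -/
lemma pow_div_ceil_le_exp {T hstar h η : ℝ} (hT : 0 < T) (hh : h ∈ Set.Ioc 0 hstar) (hη0 : 0 < η)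
    (hη1 : η < 1) (m : ℕ) :
    (1 - η) ^ (m / ⌈T / h⌉₊) ≤
      (1 - η)⁻¹ * Real.exp (-(-Real.log (1 - η) / (T + hstar)) * m * h) := by
  have hpos : 0 < 1 - η := sub_pos.2 hη1
  have hlog : Real.log (1 - η) < 0 := Real.log_neg hpos (sub_lt_self 1 hη0)
  have hN : 0 < ⌈T / h⌉₊ := Nat.ceil_pos.2 (div_pos hT hh.1)
  have hsum : 0 < T + hstar := add_pos hT (hh.1.trans_le hh.2)
  have hN_le : (⌈T / h⌉₊ : ℝ) * h ≤ T + hstar := by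
    have := (Nat.ceil_lt_add_one (div_pos hT hh.1).le).le
    calc (⌈T / h⌉₊ : ℝ) * h ≤ (T / h + 1) * h := by gcongr; exact hh.1.le
      _ = T + h := by field_simp [hh.1.ne']
      _ ≤ T + hstar := by linarith [hh.2]
  have hm_lt : (m : ℝ) ≤ ⌈T / h⌉₊ * ((m / ⌈T / h⌉₊ : ℕ) + 1) := by
    exact_mod_cast (Nat.lt_mul_div_succ m hN).le
  have hbound : m * h / (T + hstar) - 1 ≤ ((m / ⌈T / h⌉₊ : ℕ) : ℝ) := by
    rw [sub_le_iff_le_add, div_le_iff₀ hsum]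
    calc m * h ≤ ⌈T / h⌉₊ * ((m / ⌈T / h⌉₊ : ℕ) + 1) * h := by gcongr; exact hh.1.le
      _ = ((m / ⌈T / h⌉₊ : ℕ) + 1) * (⌈T / h⌉₊ * h) := by ring
      _ ≤ _ := by gcongr
  calc (1 - η) ^ (m / ⌈T / h⌉₊)
      = Real.exp (Real.log (1 - η) * (m / ⌈T / h⌉₊ : ℕ)) := by
        rw [mul_comm, Real.exp_nat_mul, Real.exp_log hpos]
    _ ≤ Real.exp (Real.log (1 - η) * (m * h / (T + hstar) - 1)) :=
        Real.exp_le_exp.2 (mul_le_mul_of_nonpos_left hbound hlog.le)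
    _ = (1 - η)⁻¹ * Real.exp (-(-Real.log (1 - η) / (T + hstar)) * m * h) := by
        conv_rhs => rw [← Real.exp_log hpos, ← Real.exp_neg, ← Real.exp_add]
        rw [Real.exp_log hpos]
        congr 1
        ring

/-- Uniform-in-the-time-step geometric ergodicity: if a family of Markov kernels `(P_h)_{0<h≤h*}`
satisfies the uniform minorization condition `P_h^{⌈T/h⌉}(x, A) ≥ η λ(A)` with `T`, `η`, `λ`
independent of `h`, then each `P_h` has a unique invariant probability measure `μ_h`, and there
exist constants `C > 0` and `κ > 0` independent of `h` such that, for every `h ∈ (0, h*]`, every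
bounded measurable `θ` and every `m ≥ 1`,
`sup_x |(P_h^m θ)(x) − μ_h(θ)| ≤ C e^{−κ m h} ‖θ‖_∞`. -/
theorem uniform_geometric_ergodicity_of_uniform_minorization
    {S : Type*} [MeasurableSpace S]
    (T hstar : ℝ) (hT : 0 < T) (hstar_pos : 0 < hstar)
    (η : ℝ) (hη0 : 0 < η) (hη1 : η ≤ 1)
    (lam : Measure S) [IsProbabilityMeasure lam]
    (P : ℝ → Kernel S S)
    (hMarkov : ∀ h ∈ Set.Ioc (0 : ℝ) hstar, IsMarkovKernel (P h))
    (hminor : ∀ h ∈ Set.Ioc (0 : ℝ) hstar, ∀ x : S, ∀ A : Set S, MeasurableSet A →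
      ENNReal.ofReal η * lam A ≤ kernelIter (P h) ⌈T / h⌉₊ x A) :
    ∃ μ : ℝ → Measure S,
      (∀ h ∈ Set.Ioc (0 : ℝ) hstar,
        (IsProbabilityMeasure (μ h) ∧
          (∀ A : Set S, MeasurableSet A → μ h A = ∫⁻ x, P h x A ∂(μ h))) ∧
        (∀ ν : Measure S,
          (IsProbabilityMeasure ν ∧ (∀ A : Set S, MeasurableSet A → ν A = ∫⁻ x, P h x A ∂ν)) →
          ν = μ h)) ∧
      ∃ C κ : ℝ, 0 < C ∧ 0 < κ ∧
        ∀ h ∈ Set.Ioc (0 : ℝ) hstar, ∀ θ : S → ℝ, Measurable θ →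
          ∀ Cθ : ℝ, (∀ x, |θ x| ≤ Cθ) → ∀ m : ℕ, 1 ≤ m → ∀ x : S,
            |(∫ y, θ y ∂(kernelIter (P h) m x)) - ∫ y, θ y ∂(μ h)| ≤
              C * Real.exp (-κ * m * h) * Cθ := by
  obtain ⟨e, he0, he1, heη⟩ : ∃ e : ℝ, 0 < e ∧ e < 1 ∧ e ≤ η :=
    ⟨η / 2, by linarith, by linarith, by linarith⟩
  have hle : ∀ h ∈ Set.Ioc (0 : ℝ) hstar, ∀ x,
      ENNReal.ofReal e • lam ≤ kernelIter (P h) ⌈T / h⌉₊ x := fun h hh x ↦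
    Measure.le_iff.2 fun A hA ↦
      (mul_le_mul_left (ENNReal.ofReal_le_ofReal heη) _).trans (hminor h hh x A hA)
  have hex : ∀ h, ∃ μ : Measure S, h ∈ Set.Ioc (0 : ℝ) hstar →
      IsProbabilityMeasure μ ∧ Kernel.Invariant (P h) μ := by
    intro h
    by_cases hh : h ∈ Set.Ioc (0 : ℝ) hstar
    · have := hMarkov h hh
      obtain ⟨μ, hμ⟩ := Kernel.exists_invariant_of_minorization_kernelIter he0 he1.le (hle h hh)
      exact ⟨μ, fun _ ↦ hμ⟩
    · exact ⟨0, fun hh' ↦ absurd hh' hh⟩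
  choose μ hμ using hex
  refine ⟨μ, fun h hh ↦ ?_, 2 * (1 - e)⁻¹, -Real.log (1 - e) / (T + hstar), ?_, ?_, ?_⟩
  · have := hMarkov h hh
    obtain ⟨hprob, hinv⟩ := hμ h hh
    refine ⟨⟨hprob, Kernel.invariant_iff.1 hinv⟩, fun ν ⟨hν, hνinv⟩ ↦ ?_⟩
    exact hinv.eq_of_minorization he0 he1.le (hle h hh) (Kernel.invariant_iff.2 hνinv)
  · have : 0 < 1 - e := sub_pos.2 he1
    positivity
  · exact div_pos (neg_pos.2 (Real.log_neg (sub_pos.2 he1) (sub_lt_self 1 he0)))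
      (add_pos hT hstar_pos)
  · intro h hh θ hθ Cθ hCθ m _ x
    have := hMarkov h hh
    obtain ⟨hprob, hinv⟩ := hμ h hh
    have hC : 0 ≤ Cθ := (abs_nonneg _).trans (hCθ x)
    have hdecay := hinv.abs_integral_kernelIter_sub_le he0.le (hle h hh) hθ
      (fun y ↦ abs_le.1 (hCθ y)) (m % ⌈T / h⌉₊) (m / ⌈T / h⌉₊) x
    rw [Nat.mod_add_div] at hdecay
    calc _ ≤ (1 - e) ^ (m / ⌈T / h⌉₊) * (Cθ - -Cθ) := hdecay
      _ ≤ (1 - e)⁻¹ * Real.exp (-(-Real.log (1 - e) / (T + hstar)) * m * h) * (Cθ - -Cθ) :=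
        mul_le_mul_of_nonneg_right (pow_div_ceil_le_exp hT hh he0 he1 m) (by linarith)
      _ = _ := by ring
end

section
/- Let P be a Markov kernel on a measurable space (S, Σ), let ν₀ be a probability measure on S, and let ν_n = ν₀ P^n denote the distribution after n steps, defined by ν_{n+1}(A) = ∫_S P(x, A) ν_n(dx). Let h > 0, m ∈ ℝ, ε ≥ 0, let φ : S → ℝ be bounded measurable, and suppose there exists a bounded measurable function ψ : S → ℝ with sup_{x}|ψ(x)| ≤ M such that |(Pψ)(x) − ψ(x) + h(φ(x) − m)| ≤ ε h² for every x ∈ S. Then for every integer N ≥ 1, | (1/N) Σ_{n=0}^{N−1} ∫_S φ dν_n − m | ≤ ε h + 2M/(N h). -/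
open MeasureTheory ProbabilityTheory

/-- Integrating the pointwise one-step consistency bound for a Markov kernel against a probability
measure `μ` bounds the one-step increment of the `ψ`-average. -/
theorem abs_integral_bind_sub_integral_add_le
    {S : Type*} [MeasurableSpace S] (P : Kernel S S) [IsMarkovKernel P]
    (μ : Measure S) [IsProbabilityMeasure μ] {h m δ : ℝ} {φ ψ : S → ℝ}
    (hφ : Integrable φ μ) (hψ : Integrable ψ μ) (hψP : Integrable ψ (μ.bind P))
    (hδ : ∀ x, |(∫ y, ψ y ∂(P x)) - ψ x + h * (φ x - m)| ≤ δ) :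
    |(∫ x, ψ x ∂(μ.bind P)) - (∫ x, ψ x ∂μ) + h * ((∫ x, φ x ∂μ) - m)| ≤ δ := by
  have hcomp : Integrable ψ ((P ∘ₖ Kernel.const Unit μ) ()) := by
    rwa [← Measure.comp_eq_comp_const_apply]
  have hPψ : Integrable (fun x => ∫ y, ψ y ∂(P x)) μ := by
    simpa only [Kernel.const_apply] using hcomp.integral_comp
  have hbind : ∫ x, ψ x ∂(μ.bind P) = ∫ x, ∫ y, ψ y ∂(P x) ∂μ := by
    simpa only [Measure.comp_eq_comp_const_apply, Kernel.const_apply] using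
      Kernel.integral_comp hcomp
  have hdiff : Integrable (fun x => (∫ y, ψ y ∂(P x)) - ψ x) μ := hPψ.sub hψ
  have hobs : Integrable (fun x => h * (φ x - m)) μ :=
    (hφ.sub (integrable_const m)).const_mul h
  have heq : (∫ x, ψ x ∂(μ.bind P)) - (∫ x, ψ x ∂μ) + h * ((∫ x, φ x ∂μ) - m) =
      ∫ x, (∫ y, ψ y ∂(P x)) - ψ x + h * (φ x - m) ∂μ := by
    rw [integral_add hdiff hobs, integral_sub hPψ hψ, integral_const_mul,
      integral_sub hφ (integrable_const m), hbind]
    simp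
  rw [heq]
  simpa using norm_integral_le_of_norm_le_const (μ := μ)
    (f := fun x => (∫ y, ψ y ∂(P x)) - ψ x + h * (φ x - m)) (.of_forall hδ)

/-- A telescoping estimate: if the increments of a bounded sequence `b` nearly cancel `h (a n - m)`,
then the averages of `a` are close to `m`. -/
theorem abs_average_sub_le_of_abs_increment_add_le
    {a b : ℕ → ℝ} {h m ε M : ℝ} (hh : 0 < h) (hb : ∀ n, |b n| ≤ M)
    (hstep : ∀ n, |b (n + 1) - b n + h * (a n - m)| ≤ ε * h ^ 2) {N : ℕ} (hN : 1 ≤ N) :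
    |(1 / (N : ℝ)) * ∑ n ∈ Finset.range N, a n - m| ≤ ε * h + 2 * M / ((N : ℝ) * h) := by
  have hN0 : (0 : ℝ) < N := by exact_mod_cast hN
  have hNh : 0 < (N : ℝ) * h := mul_pos hN0 hh
  have hsum : |∑ n ∈ Finset.range N, (b (n + 1) - b n + h * (a n - m))| ≤ N * (ε * h ^ 2) := by
    refine (Finset.abs_sum_le_sum_abs _ _).trans ?_
    simpa using Finset.sum_le_sum fun n (_ : n ∈ Finset.range N) => hstep n
  have htel : ∑ n ∈ Finset.range N, (b (n + 1) - b n + h * (a n - m)) =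
      b N - b 0 + N * h * ((1 / (N : ℝ)) * ∑ n ∈ Finset.range N, a n - m) := by
    rw [Finset.sum_add_distrib, Finset.sum_range_sub, ← Finset.mul_sum, Finset.sum_sub_distrib]
    simp only [Finset.sum_const, Finset.card_range, nsmul_eq_mul]
    field_simp
  rw [htel] at hsum
  set A := (1 / (N : ℝ)) * ∑ n ∈ Finset.range N, a n - m
  have hA : N * h * |A| ≤ N * (ε * h ^ 2) + 2 * M := by
    rw [← abs_of_pos hNh, ← abs_mul]
    have hbN := abs_le.1 (hb N)
    have hb0 := abs_le.1 (hb 0)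
    have hs := abs_le.1 hsum
    exact abs_le.2 ⟨by linarith, by linarith⟩
  calc |A| ≤ (N * (ε * h ^ 2) + 2 * M) / (N * h) := by
        rw [le_div_iff₀ hNh]
        linarith
    _ = ε * h + 2 * M / (N * h) := by
        field_simp

/-- First-order time-averaging estimate: if `ψ` is an approximate solution of the Poisson
equation for the observable `φ` with one-step consistency error `|Pψ − ψ + h(φ − m)| ≤ ε h²`
and `sup |ψ| ≤ M`, then for the distributions `ν_n = ν₀ P^n` of a Markov chain one has
`|(1/N) Σ_{n<N} ν_n(φ) − m| ≤ ε h + 2M/(N h)`. -/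
theorem first_order_time_averaging_estimate
    {S : Type*} [MeasurableSpace S]
    (P : Kernel S S) [IsMarkovKernel P]
    (ν : ℕ → Measure S) (hν0 : IsProbabilityMeasure (ν 0))
    (hνrec : ∀ n : ℕ, ν (n + 1) = (ν n).bind (fun x => P x))
    (h m ε M : ℝ) (hh : 0 < h) (hε : 0 ≤ ε)
    (φ ψ : S → ℝ) (hφmeas : Measurable φ) (hφbd : ∃ Cφ : ℝ, ∀ x, |φ x| ≤ Cφ)
    (hψmeas : Measurable ψ) (hψbd : ∀ x, |ψ x| ≤ M)
    (hconsist : ∀ x : S, |(∫ y, ψ y ∂(P x)) - ψ x + h * (φ x - m)| ≤ ε * h ^ 2) :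
    ∀ N : ℕ, 1 ≤ N →
      |(1 / (N : ℝ)) * ∑ n ∈ Finset.range N, ∫ x, φ x ∂(ν n) - m| ≤
        ε * h + 2 * M / ((N : ℝ) * h) := by
  obtain ⟨Cφ, hCφ⟩ := hφbd
  have hprob : ∀ n, IsProbabilityMeasure (ν n) := by
    intro n
    induction n with
    | zero => exact hν0
    | succ n ih =>
      rw [hνrec n]
      change IsProbabilityMeasure ((ν n).bind P)
      infer_instance
  have hφint : ∀ n, Integrable φ (ν n) := fun n =>
    .of_bound hφmeas.aestronglyMeasurable Cφ (.of_forall hCφ)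
  have hψint : ∀ n, Integrable ψ (ν n) := fun n =>
    .of_bound hψmeas.aestronglyMeasurable M (.of_forall hψbd)
  intro N hN
  refine abs_average_sub_le_of_abs_increment_add_le (a := fun n => ∫ x, φ x ∂(ν n))
    (b := fun n => ∫ x, ψ x ∂(ν n)) hh (fun n => ?_) (fun n => ?_) hN
  · simpa using norm_integral_le_of_norm_le_const (μ := ν n) (f := ψ) (.of_forall hψbd)
  · have hψP := hψint (n + 1)
    rw [hνrec n] at hψP
    simp only [hνrec n]
    exact abs_integral_bind_sub_integral_add_le P (ν n) (hφint n) (hψint n) hψP hconsist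
end

section
/- Let P be a Markov kernel on a measurable space (S, Σ), let ν₀ be a probability measure on S, and let ν_n = ν₀ P^n denote the distribution after n steps. Let h > 0, m ∈ ℝ, ε ≥ 0, ε₂ ≥ 0, let φ, g : S → ℝ be bounded measurable, and suppose there exist bounded measurable functions ψ, ψ₂ : S → ℝ with sup_x |ψ(x)| ≤ M and sup_x |ψ₂(x)| ≤ M₂ such that, for every x ∈ S, |(Pψ)(x) − ψ(x) + h(φ(x) − m) − (h²/2) g(x)| ≤ ε h³ and |(Pψ₂)(x) − ψ₂(x) + h g(x)| ≤ ε₂ h². Then for every integer N ≥ 1, | (1/N) Σ_{n=0}^{N−1} ∫_S φ dν_n − m | ≤ (ε + ε₂/2) h² + 2M/(N h) + M₂/N. -/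
open MeasureTheory ProbabilityTheory

/-- The laws of a Markov chain started from a probability measure are probability measures. -/
theorem isProbabilityMeasure_of_bind_rec {S : Type*} [MeasurableSpace S]
    (P : Kernel S S) [IsMarkovKernel P] (ν : ℕ → Measure S) (hν0 : IsProbabilityMeasure (ν 0))
    (hνrec : ∀ n : ℕ, ν (n + 1) = (ν n).bind (fun x => P x)) (n : ℕ) :
    IsProbabilityMeasure (ν n) := by
  induction n with
  | zero => exact hν0
  | succ n ih => rw [hνrec]; infer_instance

/-- The integral of a function bounded by `B` against a probability measure is bounded by `B`. -/
theorem abs_integral_le_of_forall_abs_le {S : Type*} [MeasurableSpace S]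
    (μ : Measure S) [IsProbabilityMeasure μ] {f : S → ℝ} {B : ℝ} (hfB : ∀ x, |f x| ≤ B) :
    |∫ x, f x ∂μ| ≤ B := by
  have hle : ‖∫ x, f x ∂μ‖ ≤ B * μ.real Set.univ :=
    norm_integral_le_of_norm_le_const (Filter.Eventually.of_forall hfB)
  simpa using hle

/-- Integration against the law `μP` obtained by one step of the kernel `P`. -/
theorem integral_bind_kernel {S T : Type*} [MeasurableSpace S] [MeasurableSpace T]
    (P : Kernel S T) [IsSFiniteKernel P] (μ : Measure S) [SFinite μ] {f : T → ℝ}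
    (hf : Integrable f (μ.bind P)) :
    ∫ y, f y ∂(μ.bind P) = ∫ x, ∫ y, f y ∂(P x) ∂μ := by
  have hbind : (P ∘ₖ Kernel.const Unit μ) () = μ.bind P := by
    rw [Kernel.comp_apply, Kernel.const_apply]
  rw [← hbind] at hf ⊢
  rw [Kernel.integral_comp hf, Kernel.const_apply]

/-- One-step estimate: integrating a pointwise bound on the defect `Pf - f + u` against a law. -/
theorem abs_integral_bind_sub_add_le {S : Type*} [MeasurableSpace S]
    (P : Kernel S S) [IsMarkovKernel P] (μ : Measure S) [IsProbabilityMeasure μ]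
    {f u : S → ℝ} {B δ : ℝ} (hf : Measurable f) (hfB : ∀ x, |f x| ≤ B) (hu : Integrable u μ)
    (hδ : ∀ x, |(∫ y, f y ∂(P x)) - f x + u x| ≤ δ) :
    |(∫ x, f x ∂(μ.bind (fun x => P x))) - ∫ x, f x ∂μ + ∫ x, u x ∂μ| ≤ δ := by
  have hint : ∀ ρ : Measure S, IsProbabilityMeasure ρ → Integrable f ρ := fun ρ _ =>
    Integrable.of_bound hf.aestronglyMeasurable B (Filter.Eventually.of_forall hfB)
  have hbind : Integrable f (μ.bind P) := hint _ inferInstance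
  have hPf : Integrable (fun x => ∫ y, f y ∂(P x)) μ :=
    Integrable.of_bound hf.stronglyMeasurable.integral_kernel.aestronglyMeasurable B
      (Filter.Eventually.of_forall fun x => abs_integral_le_of_forall_abs_le (P x) hfB)
  have hdiff : Integrable (fun x => (∫ y, f y ∂(P x)) - f x) μ := hPf.sub (hint μ inferInstance)
  rw [show μ.bind (fun x => P x) = μ.bind P from rfl, integral_bind_kernel P μ hbind,
    ← integral_sub hPf (hint μ inferInstance), ← integral_add hdiff hu]
  exact abs_integral_le_of_forall_abs_le μ hδ

/-- Time-averaging estimate from a single approximate Poisson solution `f` with defect `δ`. -/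
theorem abs_time_average_sub_le {S : Type*} [MeasurableSpace S]
    (P : Kernel S S) [IsMarkovKernel P] (ν : ℕ → Measure S) (hν0 : IsProbabilityMeasure (ν 0))
    (hνrec : ∀ n : ℕ, ν (n + 1) = (ν n).bind (fun x => P x))
    {h m δ B C : ℝ} (hh : 0 < h) {φ f : S → ℝ} (hφ : Measurable φ) (hφC : ∀ x, |φ x| ≤ C)
    (hf : Measurable f) (hfB : ∀ x, |f x| ≤ B)
    (hδ : ∀ x, |(∫ y, f y ∂(P x)) - f x + h * (φ x - m)| ≤ δ) {N : ℕ} (hN : 1 ≤ N) :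
    |(1 / (N : ℝ)) * ∑ n ∈ Finset.range N, ∫ x, φ x ∂(ν n) - m| ≤
      (N * δ + 2 * B) / (N * h) := by
  have hprob := isProbabilityMeasure_of_bind_rec P ν hν0 hνrec
  have hstep : ∀ n, |(∫ x, f x ∂(ν (n + 1))) - ∫ x, f x ∂(ν n)
      + h * ((∫ x, φ x ∂(ν n)) - m)| ≤ δ := by
    intro n
    have := hprob n
    have hφint : Integrable φ (ν n) :=
      Integrable.of_bound hφ.aestronglyMeasurable C (Filter.Eventually.of_forall hφC)
    have key := abs_integral_bind_sub_add_le P (ν n) hf hfB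
      ((hφint.sub (integrable_const m)).const_mul h) hδ
    rw [← hνrec] at key
    simpa [integral_const_mul, integral_sub hφint (integrable_const m)] using key
  have hbd : ∀ n, |∫ x, f x ∂(ν n)| ≤ B := fun n => by
    have := hprob n
    exact abs_integral_le_of_forall_abs_le (ν n) hfB
  have hsum : |(∫ x, f x ∂(ν N)) - ∫ x, f x ∂(ν 0)
      + h * (∑ n ∈ Finset.range N, ∫ x, φ x ∂(ν n) - N * m)| ≤ N * δ := by
    have hle := (Finset.abs_sum_le_sum_abs _ _).trans
      (Finset.sum_le_sum fun n (_ : n ∈ Finset.range N) => hstep n)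
    rw [Finset.sum_add_distrib, Finset.sum_range_sub (fun n => ∫ x, f x ∂(ν n)),
      ← Finset.mul_sum, Finset.sum_sub_distrib] at hle
    simpa using hle
  have hNpos : (0 : ℝ) < N := by exact_mod_cast hN
  have hNh : 0 < N * h := by positivity
  have heq : (1 / (N : ℝ)) * ∑ n ∈ Finset.range N, ∫ x, φ x ∂(ν n) - m =
      h * (∑ n ∈ Finset.range N, ∫ x, φ x ∂(ν n) - N * m) / (N * h) := by
    field_simp
  rw [heq, abs_div, abs_of_pos hNh]
  gcongr
  have h0 := abs_le.1 (hbd 0)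
  have hN' := abs_le.1 (hbd N)
  have hs := abs_le.1 hsum
  exact abs_le.2 ⟨by linarith, by linarith⟩

/-- Second-order time-averaging estimate: if `ψ` is an approximate Poisson solution for `φ` with
one-step error `|Pψ − ψ + h(φ − m) − (h²/2) g| ≤ ε h³` and `ψ₂` an approximate Poisson solution
for the correction `g` with `|Pψ₂ − ψ₂ + h g| ≤ ε₂ h²`, then for the distributions `ν_n = ν₀ P^n`
of a Markov chain one has `|(1/N) Σ_{n<N} ν_n(φ) − m| ≤ (ε + ε₂/2) h² + 2M/(N h) + M₂/N`. -/
theorem second_order_time_averaging_estimate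
    {S : Type*} [MeasurableSpace S]
    (P : Kernel S S) [IsMarkovKernel P]
    (ν : ℕ → Measure S) (hν0 : IsProbabilityMeasure (ν 0))
    (hνrec : ∀ n : ℕ, ν (n + 1) = (ν n).bind (fun x => P x))
    (h m ε ε₂ M M₂ : ℝ) (hh : 0 < h) (hε : 0 ≤ ε) (hε₂ : 0 ≤ ε₂)
    (φ g : S → ℝ) (hφmeas : Measurable φ) (hφbd : ∃ Cφ : ℝ, ∀ x, |φ x| ≤ Cφ)
    (hgmeas : Measurable g) (hgbd : ∃ Cg : ℝ, ∀ x, |g x| ≤ Cg)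
    (ψ ψ₂ : S → ℝ) (hψmeas : Measurable ψ) (hψbd : ∀ x, |ψ x| ≤ M)
    (hψ₂meas : Measurable ψ₂) (hψ₂bd : ∀ x, |ψ₂ x| ≤ M₂)
    (hconsist : ∀ x : S,
      |(∫ y, ψ y ∂(P x)) - ψ x + h * (φ x - m) - h ^ 2 / 2 * g x| ≤ ε * h ^ 3)
    (hconsist₂ : ∀ x : S, |(∫ y, ψ₂ y ∂(P x)) - ψ₂ x + h * g x| ≤ ε₂ * h ^ 2) :
    ∀ N : ℕ, 1 ≤ N →
      |(1 / (N : ℝ)) * ∑ n ∈ Finset.range N, ∫ x, φ x ∂(ν n) - m| ≤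
        (ε + ε₂ / 2) * h ^ 2 + 2 * M / ((N : ℝ) * h) + M₂ / (N : ℝ) := by
  intro N hN
  obtain ⟨C, hC⟩ := hφbd
  have hint : ∀ {f : S → ℝ} {B : ℝ}, Measurable f → (∀ x, |f x| ≤ B) → ∀ x, Integrable f (P x) :=
    fun hf hB x =>
      Integrable.of_bound hf.aestronglyMeasurable _ (Filter.Eventually.of_forall hB)
  have hbound : ∀ x, |ψ x + h / 2 * ψ₂ x| ≤ M + h / 2 * M₂ := fun x => by
    refine (abs_add_le _ _).trans (add_le_add (hψbd x) ?_)
    rw [abs_mul, abs_of_pos (half_pos hh)]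
    gcongr
    exact hψ₂bd x
  have hdefect : ∀ x, |(∫ y, (ψ y + h / 2 * ψ₂ y) ∂(P x)) - (ψ x + h / 2 * ψ₂ x)
      + h * (φ x - m)| ≤ (ε + ε₂ / 2) * h ^ 3 := fun x => by
    rw [integral_add (hint hψmeas hψbd x) ((hint hψ₂meas hψ₂bd x).const_mul _),
      integral_const_mul]
    have h₂ : |h / 2 * ((∫ y, ψ₂ y ∂(P x)) - ψ₂ x + h * g x)| ≤ h / 2 * (ε₂ * h ^ 2) := by
      rw [abs_mul, abs_of_pos (half_pos hh)]
      gcongr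
      exact hconsist₂ x
    calc _ = |((∫ y, ψ y ∂(P x)) - ψ x + h * (φ x - m) - h ^ 2 / 2 * g x)
          + h / 2 * ((∫ y, ψ₂ y ∂(P x)) - ψ₂ x + h * g x)| := by congr 1; ring
      _ ≤ ε * h ^ 3 + h / 2 * (ε₂ * h ^ 2) :=
        (abs_add_le _ _).trans (add_le_add (hconsist x) h₂)
      _ = (ε + ε₂ / 2) * h ^ 3 := by ring
  have hNpos : (0 : ℝ) < N := by exact_mod_cast hN
  refine (abs_time_average_sub_le P ν hν0 hνrec hh hφmeas hC
    (hψmeas.add (hψ₂meas.const_mul (h / 2))) hbound hdefect hN).trans_eq ?_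
  field_simp
  ring
end
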